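/- arXiv:2105.09815 — 7 statements merged into one kernel-verified Lean document; each statement's English description precedes it below -/
import Mathlib

section
/- Let d ≥ 2 and let μ be a nonzero locally finite Borel measure on ℝ^d. Let (G_α)_{α>0} be a sub-Markovian resolvent family on L¹(μ), i.e. each G_α is a positive linear operator on L¹(μ), αG_α is a contraction, G_α f ≤ G_β f μ-a.e. whenever 0 < β ≤ α and f ≥ 0 μ-a.e., and α G_α f → f in L¹(μ) as α → ∞ for every f ∈ L¹(μ). For f ∈ L¹(μ) with f ≥ 0 μ-a.e., let Gf : ℝ^d → [0,∞] be a measurable function such that G_{1/n} f increases μ-a.e. to Gf as n → ∞. If μ({x : 0 < Gf(x) < ∞}) = 0, then Gf(x) = ∞ for μ-almost every x with f(x) > 0. -/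
open MeasureTheory Filter ENNReal

namespace Stmt2

variable {E : Type*} [MeasurableSpace E]

/-- `(G α)_{α > 0}` is a sub-Markovian resolvent family on `L¹(μ)`: each `G α` is positive,
`α • G α` is a contraction, `G α f ≤ G β f` a.e. for `0 < β ≤ α` and `f ≥ 0` a.e., and
`α • G α f → f` in `L¹(μ)` as `α → ∞`. -/
def IsSubMarkovianResolvent (μ : Measure E) (G : ℝ → (Lp ℝ 1 μ →ₗ[ℝ] Lp ℝ 1 μ)) : Prop :=
  (∀ α, 0 < α → ∀ f : Lp ℝ 1 μ, (0 : E → ℝ) ≤ᵐ[μ] ⇑f → (0 : E → ℝ) ≤ᵐ[μ] ⇑(G α f)) ∧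
  (∀ α, 0 < α → ∀ f : Lp ℝ 1 μ, ‖α • G α f‖ ≤ ‖f‖) ∧
  (∀ α β, 0 < β → β ≤ α → ∀ f : Lp ℝ 1 μ, (0 : E → ℝ) ≤ᵐ[μ] ⇑f →
      ⇑(G α f) ≤ᵐ[μ] ⇑(G β f)) ∧
  (∀ f : Lp ℝ 1 μ, Tendsto (fun α : ℝ => α • G α f) atTop (nhds f))

/-- `F` is the potential `G f` of `f`: a measurable `[0,∞]`-valued function to which
`G (1/n) f` increases `μ`-a.e. as `n → ∞`. -/
def IsPotential (μ : Measure E) (G : ℝ → (Lp ℝ 1 μ →ₗ[ℝ] Lp ℝ 1 μ))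
    (f : Lp ℝ 1 μ) (F : E → ℝ≥0∞) : Prop :=
  Measurable F ∧
    ∀ᵐ x ∂μ, Monotone (fun n : ℕ => ENNReal.ofReal ((G (1 / (n + 1 : ℝ)) f : E → ℝ) x)) ∧
      Tendsto (fun n : ℕ => ENNReal.ofReal ((G (1 / (n + 1 : ℝ)) f : E → ℝ) x)) atTop
        (nhds (F x))

end Stmt2

open Stmt2

/-- Let `μ` be a nonzero locally finite Borel measure on `ℝ^d`, `d ≥ 2`, and
`(G α)` a sub-Markovian resolvent family on `L¹(μ)`.  If `f ∈ L¹(μ)` is a.e. nonnegative and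
its potential `F = G f` satisfies `μ({0 < F < ∞}) = 0`, then `F = ∞` `μ`-a.e. on `{f > 0}`. -/
theorem stmt2 (d : ℕ) (hd : 2 ≤ d)
    (μ : Measure (EuclideanSpace ℝ (Fin d))) [IsLocallyFiniteMeasure μ] (hμ : μ ≠ 0)
    (G : ℝ → (Lp ℝ 1 μ →ₗ[ℝ] Lp ℝ 1 μ))
    (hG : IsSubMarkovianResolvent μ G)
    (f : Lp ℝ 1 μ) (hf : (0 : EuclideanSpace ℝ (Fin d) → ℝ) ≤ᵐ[μ] ⇑f)
    (F : EuclideanSpace ℝ (Fin d) → ℝ≥0∞) (hF : IsPotential μ G f F)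
    (hrec : μ {x | 0 < F x ∧ F x < ⊤} = 0) :
    ∀ᵐ x ∂μ, 0 < (f : EuclideanSpace ℝ (Fin d) → ℝ) x → F x = ⊤ := by
  obtain ⟨-, -, hmono, hlim⟩ := hG
  obtain ⟨-, hF⟩ := hF
  have hlim' : Tendsto (fun n : ℕ => ((n : ℝ) + 1) • G ((n : ℝ) + 1) f) atTop (nhds f) :=
    (hlim f).comp (tendsto_atTop_add_const_right _ _ tendsto_natCast_atTop_atTop)
  obtain ⟨ns, -, hae⟩ := (tendstoInMeasure_of_tendsto_Lp hlim').exists_seq_tendsto_ae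
  have h1 : ∀ᵐ x ∂μ, ∀ n : ℕ, (G ((n : ℝ) + 1) f) x ≤ (G 1 f) x := by
    rw [ae_all_iff]
    intro n
    exact hmono _ _ one_pos (by linarith [Nat.cast_nonneg (α := ℝ) n]) f hf
  have h2 : ∀ᵐ x ∂μ, ∀ n : ℕ, (((n : ℝ) + 1) • G ((n : ℝ) + 1) f : Lp ℝ 1 μ) x
      = ((n : ℝ) + 1) * (G ((n : ℝ) + 1) f) x := by
    rw [ae_all_iff]
    intro n
    filter_upwards [Lp.coeFn_smul ((n : ℝ) + 1) (G ((n : ℝ) + 1) f)] with x hx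
    rw [hx]; rfl
  have h3 : ∀ᵐ x ∂μ, ¬ (0 < F x ∧ F x < ⊤) := by
    rw [ae_iff]; simpa only [not_not] using hrec
  filter_upwards [hae, h1, h2, h3, hF] with x hx h1 h2 h3 hF hpos
  by_contra hne
  have hF0 : F x = 0 := by
    by_contra h0
    exact h3 ⟨pos_iff_ne_zero.mpr h0, lt_top_iff_ne_top.mpr hne⟩
  have hG1 : (G 1 f) x ≤ 0 := by
    have := hF.1.ge_of_tendsto hF.2 0
    rw [hF0] at this
    simpa using this
  refine absurd hpos (not_lt.mpr (le_of_tendsto hx (Eventually.of_forall fun i => ?_)))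
  rw [h2]
  exact mul_nonpos_of_nonneg_of_nonpos (by positivity) ((h1 _).trans hG1)
end

section
/- Let d ≥ 2. For every φ ∈ C_c^∞(ℝ^d) one has ∫_{ℝ^d} (∂φ/∂x₁)(x) · exp(x₁² − ‖x‖²) dx = 0, where x₁ denotes the first coordinate of x. Equivalently, with w(x) := ∫_0^{x₁} e^{s²} ds, one has ∫_{ℝ^d} ⟨∇w(x), ∇φ(x)⟩ e^{−‖x‖²} dx = 0 for every φ ∈ C_c^∞(ℝ^d). -/
open MeasureTheory

/-- The weight `exp (x₁² - ‖x‖²)` has zero derivative in direction `e₁`. -/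
lemma weight_hasFDerivAt {d : ℕ} (k : Fin d) (x : EuclideanSpace ℝ (Fin d)) :
    HasFDerivAt (fun x : EuclideanSpace ℝ (Fin d) => Real.exp ((x k) ^ 2 - ‖x‖ ^ 2))
      (Real.exp ((x k) ^ 2 - ‖x‖ ^ 2) •
        ((2 * x k) • (EuclideanSpace.proj k : EuclideanSpace ℝ (Fin d) →L[ℝ] ℝ)
          - 2 • innerSL ℝ x)) x := by
  have h1 : HasFDerivAt (fun x : EuclideanSpace ℝ (Fin d) => x k)
      (EuclideanSpace.proj k : EuclideanSpace ℝ (Fin d) →L[ℝ] ℝ) x :=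
    (EuclideanSpace.proj k : EuclideanSpace ℝ (Fin d) →L[ℝ] ℝ).hasFDerivAt
  have h2 := (hasStrictFDerivAt_norm_sq x).hasFDerivAt
  have h3 := ((h1.pow 2).sub h2).exp
  refine h3.congr_fderiv ?_
  ext y
  simp

lemma weight_contDiff {d : ℕ} (k : Fin d) :
    ContDiff ℝ 1 (fun x : EuclideanSpace ℝ (Fin d) => Real.exp ((x k) ^ 2 - ‖x‖ ^ 2)) := by
  have h1 : ContDiff ℝ 1 (fun x : EuclideanSpace ℝ (Fin d) => x k) :=
    (EuclideanSpace.proj k : EuclideanSpace ℝ (Fin d) →L[ℝ] ℝ).contDiff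
  exact ((h1.pow 2).sub (contDiff_norm_sq ℝ)).exp

lemma part_one {d : ℕ} (k : Fin d)
    (φ : EuclideanSpace ℝ (Fin d) → ℝ) (hφ : ContDiff ℝ (⊤ : ℕ∞) φ) (hφs : HasCompactSupport φ) :
    ∫ x : EuclideanSpace ℝ (Fin d),
        fderiv ℝ φ x (EuclideanSpace.single k 1) *
          Real.exp ((x k) ^ 2 - ‖x‖ ^ 2) = 0 := by
  have hz : ∀ x : EuclideanSpace ℝ (Fin d),
      fderiv ℝ (fun x : EuclideanSpace ℝ (Fin d) => Real.exp ((x k) ^ 2 - ‖x‖ ^ 2)) x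
        (EuclideanSpace.single k 1) = 0 := by
    intro x
    rw [(weight_hasFDerivAt k x).fderiv]
    simp [EuclideanSpace.inner_single_right]
  have hc := (weight_contDiff k).continuous
  have hd : Continuous fun x => fderiv ℝ φ x (EuclideanSpace.single k 1) :=
    (hφ.continuous_fderiv (by simp)).clm_apply continuous_const
  have key := integral_mul_fderiv_eq_neg_fderiv_mul_of_integrable
    (μ := (volume : Measure (EuclideanSpace ℝ (Fin d))))
    (f := fun x : EuclideanSpace ℝ (Fin d) => Real.exp ((x k) ^ 2 - ‖x‖ ^ 2)) (g := φ)
    (v := EuclideanSpace.single k 1) (by simp [hz])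
    ((hc.mul hd).integrable_of_hasCompactSupport
      ((hφs.fderiv_apply ℝ (EuclideanSpace.single k 1)).mul_left))
    ((hc.mul hφ.continuous).integrable_of_hasCompactSupport hφs.mul_left)
    (fun x _ => (weight_hasFDerivAt k x).differentiableAt)
    (fun x _ => hφ.differentiable (by simp) x)
  simp only [hz, zero_mul, integral_zero, neg_zero] at key
  rw [← key]
  exact integral_congr_ae (Filter.Eventually.of_forall fun x => mul_comm _ _)

/-- For every `φ ∈ C_c^∞(ℝ^d)`, `d ≥ 2`, one has
`∫ ∂₁φ(x) · exp(x₁² − ‖x‖²) dx = 0`; equivalently, with `w(x) = ∫_0^{x₁} e^{s²} ds`,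
`∫ ⟨∇w(x), ∇φ(x)⟩ e^{−‖x‖²} dx = 0`. -/
theorem stmt6 (d : ℕ) (hd : 2 ≤ d)
    (φ : EuclideanSpace ℝ (Fin d) → ℝ) (hφ : ContDiff ℝ (⊤ : ℕ∞) φ) (hφs : HasCompactSupport φ) :
    (∫ x : EuclideanSpace ℝ (Fin d),
        fderiv ℝ φ x (EuclideanSpace.single ⟨0, by omega⟩ 1) *
          Real.exp ((x ⟨0, by omega⟩) ^ 2 - ‖x‖ ^ 2) = 0) ∧
    (∀ w : EuclideanSpace ℝ (Fin d) → ℝ,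
      w = (fun x => ∫ s in (0 : ℝ)..(x ⟨0, by omega⟩), Real.exp (s ^ 2)) →
      ∫ x : EuclideanSpace ℝ (Fin d),
        (∑ i : Fin d, fderiv ℝ w x (EuclideanSpace.single i 1) *
            fderiv ℝ φ x (EuclideanSpace.single i 1)) *
          Real.exp (-‖x‖ ^ 2) = 0) := by
  refine ⟨part_one _ φ hφ hφs, ?_⟩
  rintro w rfl
  refine Eq.trans ?_ (part_one ⟨0, by omega⟩ φ hφ hφs)
  refine integral_congr_ae (Filter.Eventually.of_forall fun x => ?_)
  have h1 : HasFDerivAt (fun x : EuclideanSpace ℝ (Fin d) => x ⟨0, by omega⟩)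
      (EuclideanSpace.proj ⟨0, by omega⟩ : EuclideanSpace ℝ (Fin d) →L[ℝ] ℝ) x :=
    (EuclideanSpace.proj ⟨0, by omega⟩ : EuclideanSpace ℝ (Fin d) →L[ℝ] ℝ).hasFDerivAt
  have hc : Continuous fun s : ℝ => Real.exp (s ^ 2) := by fun_prop
  have h2 := (hc.integral_hasStrictDerivAt 0 (x ⟨0, by omega⟩)).hasDerivAt
  have h3 := h2.comp_hasFDerivAt x h1
  have h4 := h3.fderiv
  simp only [Function.comp_def] at h4
  simp only [h4]
  rw [Finset.sum_eq_single ⟨0, by omega⟩]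
  · simp only [sub_eq_add_neg, Real.exp_add]
    simp
    ring
  · intro i _ hi
    simp [Ne.symm hi]
  · simp
end

section
/- Let d ≥ 2 and define w(x) := ∫_0^{x₁} e^{s²} ds for x ∈ ℝ^d, where x₁ is the first coordinate of x. Then ∫_{ℝ^d} exp(−‖x‖² + 2 w(x)) dx = ∞, i.e. the measure μ̃ := exp(−‖x‖² + 2w(x)) dx is an infinite measure. -/
open MeasureTheory

lemma aux_w (t : ℝ) (ht : 0 ≤ t) : t ^ 2 ≤ ∫ s in (0 : ℝ)..t, Real.exp (s ^ 2) := by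
  have h1 : ∫ s in (0 : ℝ)..t, 2 * s = t ^ 2 := by
    rw [intervalIntegral.integral_const_mul, integral_id]; ring
  rw [← h1]
  apply intervalIntegral.integral_mono_on ht
  · exact (by fun_prop : Continuous fun s : ℝ => 2 * s).intervalIntegrable _ _
  · exact (by fun_prop : Continuous fun s : ℝ => Real.exp (s ^ 2)).intervalIntegrable _ _
  · intro s _
    nlinarith [Real.add_one_le_exp (s ^ 2), sq_nonneg (s - 1)]

lemma aux_vol (d : ℕ) (i0 : Fin d) :
    volume ((fun x : EuclideanSpace ℝ (Fin d) => (x.ofLp : Fin d → ℝ)) ⁻¹'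
      (Set.univ.pi fun i => if i = i0 then Set.Ici (0 : ℝ) else Set.Icc 0 1)) = ⊤ := by
  have hm : MeasurableSet
      (Set.univ.pi fun i : Fin d => if i = i0 then Set.Ici (0 : ℝ) else Set.Icc 0 1) := by
    apply MeasurableSet.univ_pi
    intro i
    split_ifs
    · exact measurableSet_Ici
    · exact measurableSet_Icc
  rw [(PiLp.volume_preserving_ofLp (Fin d)).measure_preimage hm.nullMeasurableSet,
    volume_pi_pi, ← Finset.mul_prod_erase _ _ (Finset.mem_univ i0)]
  rw [Finset.prod_eq_one]
  · simp
  · intro i hi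
    simp [Finset.ne_of_mem_erase hi]

/-- For `d ≥ 2` and `w(x) = ∫_0^{x₁} e^{s²} ds`, the measure
`μ̃ = exp(−‖x‖² + 2w(x)) dx` on `ℝ^d` is infinite, i.e.
`∫ exp(−‖x‖² + 2w(x)) dx = ∞`. -/
theorem stmt7 (d : ℕ) (hd : 2 ≤ d) :
    ∫⁻ x : EuclideanSpace ℝ (Fin d),
      ENNReal.ofReal
        (Real.exp (-‖x‖ ^ 2 + 2 * ∫ s in (0 : ℝ)..(x ⟨0, by omega⟩), Real.exp (s ^ 2))) = ⊤ := by
  have hv := aux_vol d ⟨0, by omega⟩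
  set S := ((fun x : EuclideanSpace ℝ (Fin d) => (x.ofLp : Fin d → ℝ)) ⁻¹'
      (Set.univ.pi fun i => if i = ⟨0, by omega⟩ then Set.Ici (0 : ℝ) else Set.Icc 0 1)) with hS
  have hSm : MeasurableSet S := by
    apply (PiLp.volume_preserving_ofLp (Fin d)).measurable
    apply MeasurableSet.univ_pi
    intro i
    split_ifs
    · exact measurableSet_Ici
    · exact measurableSet_Icc
  have hc : ∫⁻ _ in S, ENNReal.ofReal (Real.exp (-(d : ℝ))) = ⊤ := by
    rw [setLIntegral_const, hv, ENNReal.mul_top]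
    simpa using Real.exp_pos _
  rw [eq_top_iff, ← hc]
  refine le_trans (setLIntegral_mono' hSm ?_) (setLIntegral_le_lintegral S _)
  intro x hx
  have hx' : ∀ i, x i ∈ (if i = ⟨0, by omega⟩ then Set.Ici (0 : ℝ) else Set.Icc 0 1) :=
    fun i => hx i (Set.mem_univ i)
  apply ENNReal.ofReal_le_ofReal
  apply Real.exp_le_exp.mpr
  have h0 : 0 ≤ x ⟨0, by omega⟩ := by simpa using hx' ⟨0, by omega⟩
  have hw := aux_w _ h0
  have hn : ‖x‖ ^ 2 ≤ x ⟨0, by omega⟩ ^ 2 + d := by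
    rw [EuclideanSpace.real_norm_sq_eq]
    calc ∑ i, x i ^ 2 ≤ ∑ i : Fin d, ((if i = ⟨0, by omega⟩ then x ⟨0, by omega⟩ ^ 2 else 0) + 1) := by
          apply Finset.sum_le_sum
          intro i _
          have := hx' i
          split_ifs at this ⊢ with h
          · subst h; linarith
          · nlinarith [this.1, this.2]
      _ = _ := by simp [Finset.sum_add_distrib]
  nlinarith [sq_nonneg (x ⟨0, by omega⟩)]
end

section
/- Let d ≥ 2 and let c ∈ ℝ^d be a constant vector. For every f ∈ C_c^∞(ℝ^d) one has ∫_{ℝ^d} ( ½ Δf(x) + ⟨c, ∇f(x)⟩ ) (1 + e^{2⟨c,x⟩}) dx = 0. -/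
open MeasureTheory
open scoped RealInnerProductSpace

/-- The Laplacian `Δf = ∑ i ∂²f/∂x_i²` of a function `f : ℝ^d → ℝ`. -/
noncomputable def laplacian {d : ℕ} (f : EuclideanSpace ℝ (Fin d) → ℝ) :
    EuclideanSpace ℝ (Fin d) → ℝ := fun x =>
  ∑ i : Fin d,
    fderiv ℝ (fun y => fderiv ℝ f y (EuclideanSpace.single i 1)) x (EuclideanSpace.single i 1)

theorem int_fderiv_zero {d : ℕ} (g : EuclideanSpace ℝ (Fin d) → ℝ) (hg : ContDiff ℝ 1 g)
    (hgs : HasCompactSupport g) (v : EuclideanSpace ℝ (Fin d)) :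
    Integrable (fun x => fderiv ℝ g x v) ∧ ∫ x, fderiv ℝ g x v = 0 := by
  have hc : Continuous (fun x => fderiv ℝ g x v) :=
    (hg.continuous_fderiv one_ne_zero).clm_apply continuous_const
  have hi : Integrable (fun x => fderiv ℝ g x v) :=
    hc.integrable_of_hasCompactSupport (hgs.fderiv_apply ℝ v)
  refine ⟨hi, ?_⟩
  have h := integral_mul_fderiv_eq_neg_fderiv_mul_of_integrable (μ := volume)
    (f := fun _ : EuclideanSpace ℝ (Fin d) => (1 : ℝ)) (g := g) (v := v)
    (by simp) (by simpa using hi)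
    (by simpa using hg.continuous.integrable_of_hasCompactSupport hgs)
    (fun x _ => differentiableAt_const _) (fun x _ => hg.differentiable one_ne_zero x)
  simpa using h

theorem fderiv_coord {d : ℕ} (L : EuclideanSpace ℝ (Fin d) →L[ℝ] ℝ)
    (c : EuclideanSpace ℝ (Fin d)) :
    L c = ∑ i, c i * L (EuclideanSpace.single i 1) := by
  have h : c = ∑ i, c i • EuclideanSpace.single i (1 : ℝ) := by
    ext j
    simp [Pi.single_apply]
  conv_lhs => rw [h]
  simp

/-- For `d ≥ 2`, a constant vector `c ∈ ℝ^d` and every `f ∈ C_c^∞(ℝ^d)`,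
`∫ (½Δf(x) + ⟨c, ∇f(x)⟩)(1 + e^{2⟨c,x⟩}) dx = 0`, i.e. `μ̃ = (1 + e^{2⟨c,x⟩}) dx` is an
infinitesimally invariant measure for `L = ½Δ + ⟨c, ∇⟩`. -/
theorem stmt9 (d : ℕ) (hd : 2 ≤ d) (c : EuclideanSpace ℝ (Fin d))
    (f : EuclideanSpace ℝ (Fin d) → ℝ) (hf : ContDiff ℝ (⊤ : ℕ∞) f) (hfs : HasCompactSupport f) :
    ∫ x : EuclideanSpace ℝ (Fin d),
      (1 / 2 * laplacian f x + fderiv ℝ f x c) * (1 + Real.exp (2 * ⟪c, x⟫)) = 0 := by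
  set g : Fin d → EuclideanSpace ℝ (Fin d) → ℝ := fun i x =>
    1 / 2 * (1 + Real.exp (2 * ⟪c, x⟫)) * fderiv ℝ f x (EuclideanSpace.single i 1) + c i * f x
    with hgdef
  have hD : ∀ i : Fin d, ContDiff ℝ 1 (fun x => fderiv ℝ f x (EuclideanSpace.single i 1)) := by
    intro i
    have : ContDiff ℝ 1 (fderiv ℝ f) := hf.fderiv_right (by norm_cast)
    exact this.clm_apply contDiff_const
  have hf1 : ContDiff ℝ 1 f := hf.of_le (by norm_cast)
  have hg : ∀ i, ContDiff ℝ 1 (g i) := by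
    intro i
    have hE : ContDiff ℝ 1 (fun x : EuclideanSpace ℝ (Fin d) =>
      1 / 2 * (1 + Real.exp (2 * ⟪c, x⟫))) := by
      have hL : ContDiff ℝ 1 (fun x : EuclideanSpace ℝ (Fin d) => ⟪c, x⟫) :=
        (innerSL ℝ c).contDiff
      fun_prop
    exact (hE.mul (hD i)).add (contDiff_const.mul hf1)
  have hgs : ∀ i, HasCompactSupport (g i) := by
    intro i
    exact HasCompactSupport.add ((hfs.fderiv_apply ℝ _).mul_left) hfs.mul_left
  have key : ∀ x, (1 / 2 * laplacian f x + fderiv ℝ f x c) * (1 + Real.exp (2 * ⟪c, x⟫))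
      = ∑ i, fderiv ℝ (g i) x (EuclideanSpace.single i 1) := by
    intro x
    rw [fderiv_coord (fderiv ℝ f x) c, laplacian, Finset.mul_sum, ← Finset.sum_add_distrib,
      Finset.sum_mul]
    refine Finset.sum_congr rfl fun i _ => ?_
    have h1 : HasFDerivAt (fun x : EuclideanSpace ℝ (Fin d) => ⟪c, x⟫) (innerSL ℝ c) x :=
      (innerSL ℝ c).hasFDerivAt
    have h2 := (((h1.const_mul 2).exp.const_add 1).const_mul (1 / 2)).mul
      (((hD i).differentiable one_ne_zero) x).hasFDerivAt
    have h3 := h2.add (((hf1.differentiable one_ne_zero) x).hasFDerivAt.const_mul (c i))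
    have h4 : fderiv ℝ (g i) x = _ := h3.fderiv
    rw [h4]
    simp [EuclideanSpace.inner_single_right]
    ring
  simp_rw [key]
  rw [integral_finsetSum _ fun i _ => (int_fderiv_zero _ (hg i) (hgs i) _).1]
  exact Finset.sum_eq_zero fun i _ => (int_fderiv_zero _ (hg i) (hgs i) _).2
end

section
/- Let d ≥ 2. For every f ∈ C_c^∞(ℝ^d) one has ∫_{ℝ^d} ( ½ Δf(x) + (½ + ½ e^{−x₁}) (∂f/∂x₁)(x) ) e^{x₁} dx = 0, where x₁ denotes the first coordinate of x. -/
open MeasureTheory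

/-- A directional derivative of a compactly supported C^1 function is integrable with integral zero. -/
theorem aux_integral {d : ℕ} (g : EuclideanSpace ℝ (Fin d) → ℝ) (hg : ContDiff ℝ 1 g)
    (hs : HasCompactSupport g) (v : EuclideanSpace ℝ (Fin d)) :
    Integrable (fun x => fderiv ℝ g x v) ∧ ∫ x, fderiv ℝ g x v = 0 := by
  have hi : Integrable (fun x => fderiv ℝ g x v) :=
    ((hg.continuous_fderiv one_ne_zero).clm_apply continuous_const).integrable_of_hasCompactSupport
      (hs.fderiv_apply (𝕜 := ℝ) v)
  refine ⟨hi, ?_⟩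
  have := integral_mul_fderiv_eq_neg_fderiv_mul_of_integrable (μ := volume) (𝕜 := ℝ)
    (f := fun _ : EuclideanSpace ℝ (Fin d) => (1 : ℝ)) (g := g) (v := v)
    (by simp) (by simpa using hi)
    (by simpa using hg.continuous.integrable_of_hasCompactSupport hs)
    (fun x _ => differentiableAt_const _) (fun x _ => hg.differentiable one_ne_zero x)
  simpa using this

/-- The product rule for the weighted derivative. -/
theorem aux_deriv {d : ℕ} (k : Fin d) (g : EuclideanSpace ℝ (Fin d) → ℝ) (hg : ContDiff ℝ 1 g)
    (v x : EuclideanSpace ℝ (Fin d)) :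
    fderiv ℝ (fun y => Real.exp (y k) * g y) x v
      = Real.exp (x k) * fderiv ℝ g x v + v k * Real.exp (x k) * g x := by
  have h1 : HasFDerivAt (fun y : EuclideanSpace ℝ (Fin d) => y k)
      (EuclideanSpace.proj k : EuclideanSpace ℝ (Fin d) →L[ℝ] ℝ) x :=
    (EuclideanSpace.proj k : EuclideanSpace ℝ (Fin d) →L[ℝ] ℝ).hasFDerivAt
  have h2 := h1.exp.mul (hg.differentiable one_ne_zero x).hasFDerivAt
  have h3 := h2.fderiv
  have h4 := congrArg (fun L => L v) h3
  refine Eq.trans h4 ?_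
  simp
  ring

/-- For `d ≥ 2` and every `f ∈ C_c^∞(ℝ^d)`,
`∫ (½Δf(x) + (½ + ½e^{−x₁}) ∂₁f(x)) e^{x₁} dx = 0`, i.e.
`μ = e^{x₁} dx` is an infinitesimally invariant measure for
`L = ½Δ + (½ + ½e^{−x₁}) ∂₁`. -/
theorem stmt11 (d : ℕ) (hd : 2 ≤ d)
    (f : EuclideanSpace ℝ (Fin d) → ℝ) (hf : ContDiff ℝ (⊤ : ℕ∞) f) (hfs : HasCompactSupport f) :
    ∫ x : EuclideanSpace ℝ (Fin d),
      (1 / 2 * laplacian f x +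
          (1 / 2 + 1 / 2 * Real.exp (-(x ⟨0, by omega⟩))) *
            fderiv ℝ f x (EuclideanSpace.single ⟨0, by omega⟩ 1)) *
        Real.exp (x ⟨0, by omega⟩) = 0 := by
  have hF : ∀ v, ContDiff ℝ 1 (fun y => fderiv ℝ f y v) := fun v =>
    (hf.fderiv_right (m := 1) (by norm_cast)).clm_apply contDiff_const
  have hFs : ∀ v, HasCompactSupport (fun y => fderiv ℝ f y v) := fun v =>
    hfs.fderiv_apply (𝕜 := ℝ) v
  set k : Fin d := ⟨0, by omega⟩ with hk
  have hE : ContDiff ℝ 1 (fun y : EuclideanSpace ℝ (Fin d) => Real.exp (y k)) :=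
    ((EuclideanSpace.proj k : EuclideanSpace ℝ (Fin d) →L[ℝ] ℝ).contDiff).exp
  have hA := fun v => aux_integral (fun y => Real.exp (y k) * fderiv ℝ f y v)
    (hE.mul (hF v)) ((hFs v).mul_left) v
  have hB := aux_integral f (hf.of_le (by norm_cast)) hfs (EuclideanSpace.single k 1)
  have key : ∀ x : EuclideanSpace ℝ (Fin d),
      (1 / 2 * laplacian f x + (1 / 2 + 1 / 2 * Real.exp (-(x k))) *
            fderiv ℝ f x (EuclideanSpace.single k 1)) * Real.exp (x k)
      = 1 / 2 * (∑ i : Fin d, fderiv ℝ (fun y => Real.exp (y k) *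
          fderiv ℝ f y (EuclideanSpace.single i 1)) x (EuclideanSpace.single i 1))
        + 1 / 2 * fderiv ℝ f x (EuclideanSpace.single k 1) := by
    intro x
    have e : Real.exp (-(x k)) * Real.exp (x k) = 1 := by rw [← Real.exp_add]; simp
    have hsum : (∑ i : Fin d, fderiv ℝ (fun y => Real.exp (y k) *
          fderiv ℝ f y (EuclideanSpace.single i 1)) x (EuclideanSpace.single i 1))
        = Real.exp (x k) * laplacian f x
          + Real.exp (x k) * fderiv ℝ f x (EuclideanSpace.single k 1) := by
      simp only [fun i : Fin d => aux_deriv k _ (hF (EuclideanSpace.single i 1))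
        (EuclideanSpace.single i 1) x]
      rw [Finset.sum_add_distrib, ← Finset.mul_sum]
      congr 1
      rw [Finset.sum_eq_single k]
      · simp
      · intro b _ hb
        simp [hb.symm]
      · simp
    rw [hsum]
    linear_combination (1 / 2 * fderiv ℝ f x (EuclideanSpace.single k 1)) * e
  simp only [key]
  rw [integral_add ((integrable_finsetSum _ fun i _ => (hA _).1).const_mul _)
    (hB.1.const_mul _), integral_const_mul, integral_const_mul, hB.2,
    integral_finsetSum _ fun i _ => (hA _).1]
  simp [fun v => (hA v).2]
end

section
/- Define Ψ : (0,∞) → ℝ by Ψ(y) = y²(6 − y) for 0 < y ≤ 3 and Ψ(y) = 54 − 81/y for y ≥ 3. Then Ψ is twice continuously differentiable on (0,∞), satisfies 0 < Ψ(y) ≤ 54 for all y > 0, and satisfies the inequality (Ψ''(y) + Ψ'(y))·y² ≥ Ψ(y)/2 for all y > 0. -/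
/-- The auxiliary function `Ψ` of Example 4.5: `Ψ(y) = y²(6−y)` for `y ≤ 3` and
`Ψ(y) = 54 − 81/y` for `y ≥ 3`. -/
noncomputable def Psi : ℝ → ℝ := fun y => if y ≤ 3 then y ^ 2 * (6 - y) else 54 - 81 / y

theorem glue_hasDerivAt (f g df dg : ℝ → ℝ) (hf : ∀ y, 0 < y → HasDerivAt f (df y) y)
    (hg : ∀ y, 0 < y → HasDerivAt g (dg y) y) (h0 : f 3 = g 3) (h1 : df 3 = dg 3)
    (y : ℝ) (hy : 0 < y) :
    HasDerivAt (fun y => if y ≤ 3 then f y else g y) (if y ≤ 3 then df y else dg y) y := by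
  rcases lt_trichotomy y 3 with h | h | h
  · rw [if_pos h.le]
    refine (hf y hy).congr_of_eventuallyEq ?_
    filter_upwards [Iio_mem_nhds h] with z hz
    exact if_pos (le_of_lt hz)
  · subst h
    rw [if_pos le_rfl, ← hasDerivWithinAt_univ, ← Set.Iic_union_Ici (a := (3 : ℝ))]
    refine HasDerivWithinAt.union ?_ ?_
    · refine (hf 3 hy).hasDerivWithinAt.congr (fun z hz => if_pos hz) (if_pos le_rfl)
    · rw [h1]
      refine (hg 3 hy).hasDerivWithinAt.congr (fun z hz => ?_) ?_
      · rcases eq_or_lt_of_le (show (3 : ℝ) ≤ z from hz) with h | h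
        · subst h; simpa using h0
        · exact if_neg (not_le.mpr h)
      · simpa using h0
  · rw [if_neg (not_le.mpr h)]
    refine (hg y hy).congr_of_eventuallyEq ?_
    filter_upwards [Ioi_mem_nhds h] with z hz
    exact if_neg (not_le.mpr hz)

noncomputable def dPsi : ℝ → ℝ := fun y => if y ≤ 3 then 12 * y - 3 * y ^ 2 else 81 / y ^ 2

noncomputable def ddPsi : ℝ → ℝ := fun y => if y ≤ 3 then 12 - 6 * y else -162 / y ^ 3

theorem Psi_hasDerivAt (y : ℝ) (hy : 0 < y) : HasDerivAt Psi (dPsi y) y := by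
  refine glue_hasDerivAt (fun y => y ^ 2 * (6 - y)) (fun y => 54 - 81 / y)
    (fun y => 12 * y - 3 * y ^ 2) (fun y => 81 / y ^ 2) ?_ ?_ (by norm_num) (by norm_num) y hy
  · intro y _
    refine HasDerivAt.congr_deriv (f := _) (((hasDerivAt_id y).pow 2).mul ((hasDerivAt_id y).const_sub 6)) ?_
    simp; ring
  · intro y hy
    refine HasDerivAt.congr_deriv (f := _) (((hasDerivAt_const y (81 : ℝ)).div (hasDerivAt_id y) hy.ne').const_sub 54) ?_
    simp; ring

theorem dPsi_hasDerivAt (y : ℝ) (hy : 0 < y) : HasDerivAt dPsi (ddPsi y) y := by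
  refine glue_hasDerivAt (fun y => 12 * y - 3 * y ^ 2) (fun y => 81 / y ^ 2)
    (fun y => 12 - 6 * y) (fun y => -162 / y ^ 3) ?_ ?_ (by norm_num) (by norm_num) y hy
  · intro y _
    refine HasDerivAt.congr_deriv (f := _) (((hasDerivAt_id y).const_mul 12).sub (((hasDerivAt_id y).pow 2).const_mul 3)) ?_
    simp; ring
  · intro y hy
    refine HasDerivAt.congr_deriv (f := _) ((hasDerivAt_const y (81 : ℝ)).div ((hasDerivAt_id y).pow 2) (by simpa using hy.ne')) ?_
    simp; field_simp; norm_num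

theorem ddPsi_continuousOn : ContinuousOn ddPsi (Set.Ioi (0 : ℝ)) := by
  have h : Set.EqOn ddPsi (fun y => 12 - 6 * min y 3 + (-162 / (max y 3) ^ 3 + 6))
      (Set.Ioi (0 : ℝ)) := by
    intro y _
    by_cases h : y ≤ 3
    · simp only [ddPsi, if_pos h, min_eq_left h, max_eq_right h]; norm_num
    · have hlt := (not_le.mp h).le
      simp only [ddPsi, if_neg h, min_eq_right hlt, max_eq_left hlt]; ring
  refine ContinuousOn.congr (Continuous.continuousOn ?_) h
  have : ∀ y : ℝ, (max y 3) ^ 3 ≠ 0 := fun y => by positivity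
  fun_prop (disch := assumption)

theorem deriv_Psi (y : ℝ) (hy : 0 < y) : deriv Psi y = dPsi y := (Psi_hasDerivAt y hy).deriv

theorem deriv_deriv_Psi (y : ℝ) (hy : 0 < y) : deriv (deriv Psi) y = ddPsi y := by
  have : deriv Psi =ᶠ[nhds y] dPsi := by
    filter_upwards [Ioi_mem_nhds hy] with z hz using deriv_Psi z hz
  rw [this.deriv_eq, (dPsi_hasDerivAt y hy).deriv]

/-- `Ψ` is twice continuously differentiable on `(0,∞)`, satisfies
`0 < Ψ(y) ≤ 54` for all `y > 0`, and satisfies `(Ψ''(y) + Ψ'(y))·y² ≥ Ψ(y)/2` for all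
`y > 0`. -/
theorem stmt12 :
    ContDiffOn ℝ 2 Psi (Set.Ioi (0 : ℝ)) ∧
    (∀ y : ℝ, 0 < y → 0 < Psi y ∧ Psi y ≤ 54) ∧
    (∀ y : ℝ, 0 < y → (deriv (deriv Psi) y + deriv Psi y) * y ^ 2 ≥ Psi y / 2) := by
  refine ⟨?_, ?_, ?_⟩
  · rw [show (2 : WithTop ℕ∞) = 1 + 1 by norm_num, contDiffOn_succ_iff_deriv_of_isOpen isOpen_Ioi]
    refine ⟨fun y hy => (Psi_hasDerivAt y hy).differentiableAt.differentiableWithinAt,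
      by simp, ?_⟩
    rw [show (1 : WithTop ℕ∞) = 0 + 1 by norm_num, contDiffOn_succ_iff_deriv_of_isOpen isOpen_Ioi]
    refine ⟨fun y hy => ?_, by simp, ?_⟩
    · exact ((dPsi_hasDerivAt y hy).differentiableAt.differentiableWithinAt).congr
        (fun z hz => deriv_Psi z hz) (deriv_Psi y hy)
    · rw [contDiffOn_zero]
      exact ddPsi_continuousOn.congr (fun z hz => deriv_deriv_Psi z hz)
  · intro y hy
    by_cases h : y ≤ 3
    · simp only [Psi, if_pos h]
      have : 0 < 6 - y := by linarith
      refine ⟨by positivity, ?_⟩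
      nlinarith [mul_nonneg hy.le (sub_nonneg.2 h), mul_nonneg (sq_nonneg y) hy.le]
    · simp only [Psi, if_neg h]
      have hlt := not_le.mp h
      have h2 : 81 / y < 54 := by rw [div_lt_iff₀ hy]; linarith
      have h3 : 0 < 81 / y := by positivity
      constructor <;> linarith
  · intro y hy
    rw [deriv_deriv_Psi y hy, deriv_Psi y hy]
    by_cases h : y ≤ 3
    · simp only [Psi, dPsi, ddPsi, if_pos h]
      have : 0 ≤ 9 + 13 / 2 * y - 3 * y ^ 2 := by nlinarith
      nlinarith [mul_nonneg this (sq_nonneg y)]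
    · simp only [Psi, dPsi, ddPsi, if_neg h]
      have hlt := not_le.mp h
      have e : (-162 / y ^ 3 + 81 / y ^ 2) * y ^ 2 = 81 - 162 / y := by field_simp; ring
      have e2 : 162 / y = 2 * (81 / y) := by ring
      have h2 : 81 / y < 27 := by rw [div_lt_iff₀ hy]; linarith
      rw [e, e2]; linarith
end

section
/- Let d ≥ 2 and m ∈ ℝ. Define ρ : ℝ^d → ℝ by ρ(x) = 1 for ‖x‖ ≤ 1 and ρ(x) = ‖x‖^m for ‖x‖ > 1, let μ be the measure with density ρ with respect to Lebesgue measure, and let B_r denote the open Euclidean ball of radius r centered at the origin. Then ∫_1^∞ r / μ(B_r) dr = ∞ if and only if m + d ≤ 2. -/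
open MeasureTheory

/-- The density `ρ(x) = 1` for `‖x‖ ≤ 1` and `ρ(x) = ‖x‖^m` for `‖x‖ > 1`. -/
noncomputable def rho (d : ℕ) (m : ℝ) : EuclideanSpace ℝ (Fin d) → ℝ := fun x =>
  if ‖x‖ ≤ 1 then 1 else ‖x‖ ^ m

lemma rho_measurable (d : ℕ) (m : ℝ) : Measurable (rho d m) := by
  unfold rho
  refine Measurable.ite (measurableSet_le measurable_norm measurable_const) measurable_const ?_
  exact measurable_norm.pow_const m

lemma ball_upper (d : ℕ) (hd : 2 ≤ d) (m : ℝ) (hm : m + d ≤ 2) : ∃ C : ℝ, 0 < C ∧ ∀ r : ℝ, 1 < r →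
    (volume.withDensity fun x => ENNReal.ofReal (rho d m x))
      (Metric.ball (0 : EuclideanSpace ℝ (Fin d)) r) ≤ ENNReal.ofReal (C * r ^ 2) := by
  haveI : NeZero d := ⟨by omega⟩
  have hd' : (2 : ℝ) ≤ d := by exact_mod_cast hd
  set w : ℝ := volume.real (Metric.ball (0 : EuclideanSpace ℝ (Fin d)) 1) with hw
  have hwpos : 0 < w := by
    rw [hw, measureReal_def]
    exact ENNReal.toReal_pos (Metric.measure_ball_pos _ _ one_pos).ne' measure_ball_lt_top.ne
  refine ⟨d * (w * (1 / 2)), by positivity, fun r hr => ?_⟩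
  have hr0 : 0 < r := by linarith
  have key : ∀ y : ℝ, 0 < y → y ^ (d - 1) * y ^ ((2 : ℝ) - d) = y := by
    intro y hy
    rw [← Real.rpow_natCast, ← Real.rpow_add hy, Nat.cast_sub (by omega)]
    have : ((d : ℝ) - (1 : ℕ) + (2 - d)) = 1 := by push_cast; ring
    rw [this, Real.rpow_one]
  have hint : IntegrableOn (fun x : EuclideanSpace ℝ (Fin d) => ‖x‖ ^ ((2 : ℝ) - d))
      (Metric.ball 0 r) volume := by
    rw [integrableOn_fun_norm_addHaar volume (f := fun y => y ^ ((2 : ℝ) - d))]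
    have h1 : IntegrableOn (fun y : ℝ => y) (Set.Ioo 0 r) :=
      (continuous_id.integrableOn_Icc (a := 0) (b := r)).mono_set Set.Ioo_subset_Icc_self
    refine h1.congr_fun (fun y hy => ?_) measurableSet_Ioo
    simp only [finrank_euclideanSpace, Fintype.card_fin, smul_eq_mul]
    exact (key y hy.1).symm
  have hval : ∫ x in Metric.ball (0 : EuclideanSpace ℝ (Fin d)) r, ‖x‖ ^ ((2 : ℝ) - d)
      = d * (w * (1 / 2)) * r ^ 2 := by
    rw [← integral_indicator measurableSet_ball]
    have h2 := integral_fun_norm_addHaar (volume : Measure (EuclideanSpace ℝ (Fin d)))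
      ((Set.Iio r).indicator fun y => y ^ ((2 : ℝ) - d))
    have h3 : (fun x : EuclideanSpace ℝ (Fin d) => (Metric.ball 0 r).indicator
        (fun x => ‖x‖ ^ ((2 : ℝ) - d)) x)
        = fun x => (Set.Iio r).indicator (fun y => y ^ ((2 : ℝ) - d)) ‖x‖ := by
      ext x
      simp [Set.indicator]
    rw [h3, h2]
    have h4 : ∫ y in Set.Ioi (0 : ℝ), y ^ (Module.finrank ℝ (EuclideanSpace ℝ (Fin d)) - 1) •
        (Set.Iio r).indicator (fun y => y ^ ((2 : ℝ) - d)) y = r ^ 2 / 2 := by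
      have h5 : ∫ y in Set.Ioi (0 : ℝ), y ^ (Module.finrank ℝ (EuclideanSpace ℝ (Fin d)) - 1) •
        (Set.Iio r).indicator (fun y => y ^ ((2 : ℝ) - d)) y
          = ∫ y in Set.Ioi (0 : ℝ), (Set.Iio r).indicator (fun y => y) y := by
        refine setIntegral_congr_fun measurableSet_Ioi fun y hy => ?_
        simp only [finrank_euclideanSpace, Fintype.card_fin, smul_eq_mul, Set.indicator]
        split_ifs
        · exact key y hy
        · simp
      rw [h5, setIntegral_indicator measurableSet_Iio, Set.Ioi_inter_Iio,
        ← integral_Ioc_eq_integral_Ioo, ← intervalIntegral.integral_of_le hr0.le, integral_id]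
      ring
    rw [h4, ← hw]
    simp only [finrank_euclideanSpace, Fintype.card_fin, smul_eq_mul, nsmul_eq_mul]
    ring
  rw [withDensity_apply _ measurableSet_ball, ← hval, ofReal_integral_eq_lintegral_ofReal hint
    (Filter.Eventually.of_forall fun x => by positivity)]
  refine lintegral_mono_ae (ae_restrict_of_ae ?_)
  have hne : ∀ᵐ x : EuclideanSpace ℝ (Fin d), x ≠ 0 := by
    simp [ae_iff]
  filter_upwards [hne] with x hx
  apply ENNReal.ofReal_le_ofReal
  have hxp : 0 < ‖x‖ := norm_pos_iff.2 hx
  unfold rho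
  split_ifs with h
  · exact Real.one_le_rpow_of_pos_of_le_one_of_nonpos hxp h (by linarith)
  · exact Real.rpow_le_rpow_of_exponent_le (by linarith) (by linarith)

lemma ball_lower (d : ℕ) (hd : 2 ≤ d) (m : ℝ) : ∃ C : ℝ, 0 < C ∧ ∀ r : ℝ, 1 < r →
    ENNReal.ofReal (C * r ^ (m + d)) ≤ (volume.withDensity fun x => ENNReal.ofReal (rho d m x))
      (Metric.ball (0 : EuclideanSpace ℝ (Fin d)) r) := by
  haveI : NeZero d := ⟨by omega⟩
  set w : ℝ := volume.real (Metric.ball (0 : EuclideanSpace ℝ (Fin d)) 1) with hw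
  have hwpos : 0 < w := by
    rw [hw, measureReal_def]
    exact ENNReal.toReal_pos (Metric.measure_ball_pos _ _ one_pos).ne' measure_ball_lt_top.ne
  have hwe : volume (Metric.ball (0 : EuclideanSpace ℝ (Fin d)) 1) = ENNReal.ofReal w := by
    rw [hw, measureReal_def, ENNReal.ofReal_toReal measure_ball_lt_top.ne]
  refine ⟨(1 / 2 : ℝ) ^ |m| * ((1 / 4) ^ d * w), by positivity, fun r hr => ?_⟩
  have hr0 : 0 < r := by linarith
  set v : EuclideanSpace ℝ (Fin d) := EuclideanSpace.single (0 : Fin d) (3 / 4 * r) with hv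
  have hvn : ‖v‖ = 3 / 4 * r := by
    rw [hv, EuclideanSpace.norm_single, Real.norm_of_nonneg (by positivity)]
  have hb : ∀ x ∈ Metric.ball v (r / 4), r / 2 < ‖x‖ ∧ ‖x‖ < r := by
    intro x hx
    rw [mem_ball_iff_norm] at hx
    have h1 := norm_sub_norm_le x v
    have h2 := norm_sub_norm_le v x
    rw [norm_sub_rev] at h2
    constructor <;> linarith
  have hsub : Metric.ball v (r / 4) ⊆ Metric.ball 0 r := by
    intro x hx
    simpa using (hb x hx).2
  refine le_trans ?_ (measure_mono hsub)
  rw [withDensity_apply _ measurableSet_ball]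
  have hlow : ∀ x ∈ Metric.ball v (r / 4), ENNReal.ofReal ((1 / 2 : ℝ) ^ |m| * r ^ m) ≤
      ENNReal.ofReal (rho d m x) := by
    intro x hx
    obtain ⟨h1, h2⟩ := hb x hx
    apply ENNReal.ofReal_le_ofReal
    have hrho : rho d m x = (max ‖x‖ 1) ^ m := by
      unfold rho
      split_ifs with h
      · rw [max_eq_right h, Real.one_rpow]
      · rw [max_eq_left (by linarith)]
    rw [hrho]
    set t := max ‖x‖ 1
    have ht1 : r / 2 < t := lt_max_of_lt_left h1
    have ht2 : t < r := max_lt h2 hr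
    have htr : t = (t / r) * r := by field_simp
    have hu0 : 1 / 2 ≤ t / r := by rw [le_div_iff₀ hr0]; linarith
    have hu1 : t / r ≤ 1 := by rw [div_le_one hr0]; linarith
    rw [htr, Real.mul_rpow (by linarith) hr0.le]
    gcongr
    calc (1 / 2 : ℝ) ^ |m| ≤ (t / r) ^ |m| :=
          Real.rpow_le_rpow (by norm_num) hu0 (abs_nonneg m)
      _ ≤ (t / r) ^ m :=
          Real.rpow_le_rpow_of_exponent_ge (by linarith) hu1 (le_abs_self m)
  refine le_trans (le_of_eq ?_) (setLIntegral_mono' measurableSet_ball hlow)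
  rw [setLIntegral_const, Measure.addHaar_ball_of_pos _ _ (by positivity), hwe,
    ← ENNReal.ofReal_mul (by positivity), ← ENNReal.ofReal_mul (by positivity)]
  congr 1
  rw [Real.rpow_add hr0, Real.rpow_natCast]
  simp only [finrank_euclideanSpace, Fintype.card_fin]
  rw [div_eq_mul_inv r 4, mul_pow]
  ring

/-- For `d ≥ 2`, `m ∈ ℝ`, and `μ = ρ dx` with `ρ` as above, the volume-growth
integral `∫_1^∞ r/μ(B_r) dr` diverges if and only if `m + d ≤ 2`. -/
theorem stmt16 (d : ℕ) (hd : 2 ≤ d) (m : ℝ)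
    (μ : Measure (EuclideanSpace ℝ (Fin d)))
    (hμ : μ = volume.withDensity fun x => ENNReal.ofReal (rho d m x)) :
    (∫⁻ r in Set.Ioi (1 : ℝ),
        ENNReal.ofReal r / μ (Metric.ball (0 : EuclideanSpace ℝ (Fin d)) r) = ⊤) ↔
      m + d ≤ 2 := by
  subst hμ
  constructor
  · intro h
    by_contra! hm
    obtain ⟨C, hC, hb⟩ := ball_lower d hd m
    have hint : IntegrableOn (fun r : ℝ => C⁻¹ * r ^ (1 - (m + d))) (Set.Ioi 1) :=
      ((integrableOn_Ioi_rpow_iff one_pos).2 (by linarith)).const_mul _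
    refine (hint.lintegral_lt_top).ne (top_le_iff.1 ?_)
    rw [← h]
    refine setLIntegral_mono' measurableSet_Ioi fun r hr => ?_
    have hr0 : (0 : ℝ) < r := lt_trans one_pos hr
    refine (ENNReal.div_le_div_left (hb r hr) _).trans (le_of_eq ?_)
    rw [← ENNReal.ofReal_div_of_pos (by positivity)]
    congr 1
    rw [Real.rpow_sub hr0, Real.rpow_one]
    field_simp
  · intro hm
    obtain ⟨C, hC, hb⟩ := ball_upper d hd m hm
    rw [← top_le_iff]
    have hdiv : ∫⁻ r in Set.Ioi (1 : ℝ), ENNReal.ofReal (C⁻¹ * r ^ (-1 : ℝ)) = ⊤ := by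
      by_contra hne
      have hi : IntegrableOn (fun r : ℝ => C⁻¹ * r ^ (-1 : ℝ)) (Set.Ioi 1) := by
        refine (lintegral_ofReal_ne_top_iff_integrable ?_ ?_).1 hne
        · exact ((measurable_id.pow_const _).const_mul _).aestronglyMeasurable
        · filter_upwards [ae_restrict_mem measurableSet_Ioi] with r hr
          have hr0 : (0 : ℝ) < r := lt_trans one_pos hr
          simp only [Pi.zero_apply]
          positivity
      have hi2 := hi.const_mul C
      simp only [← mul_assoc, mul_inv_cancel₀ hC.ne', one_mul] at hi2
      have := (integrableOn_Ioi_rpow_iff one_pos).1 hi2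
      linarith
    rw [← hdiv]
    refine setLIntegral_mono' measurableSet_Ioi fun r hr => ?_
    have hr0 : (0 : ℝ) < r := lt_trans one_pos hr
    refine (le_of_eq ?_).trans (ENNReal.div_le_div_left (hb r hr) _)
    rw [← ENNReal.ofReal_div_of_pos (by positivity)]
    congr 1
    rw [Real.rpow_neg_one]
    field_simp
end
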